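/- For every δ ∈ ℕ and every pair of coprime polynomials A, B ∈ ℂ[x,y], not both zero, there exist integers d1, d2 and bigraded homogeneous polynomials A0, A1, B0, B1 ∈ ℂ[X0,X1,Y0,Y1] of respective bidegrees (d1−δ+1, d2+2), (d1−δ+1, d2+2), (d1−δ+2, d2+1) and (d1+2, d2+1), such that: (1) X0·A0 + X1·A1 − δ·Y1·B1 = 0 and Y0·B0 + Y1·B1 = 0; (2) A0, A1, B0, B1 have no nonconstant common factor; and (3) A1(1,x,1,y) = A(x,y) and B1(1,x,1,y) = B(x,y). -/

import Mathlib

open MvPolynomial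

noncomputable section

/-- With respect to the bigrading of `ℂ[X0,X1,Y0,Y1]` in which `X0, X1` have
bidegree `(1,0)`, `Y0` has bidegree `(0,1)` and `Y1` has bidegree `(−δ,1)`
(variables `0 = X0`, `1 = X1`, `2 = Y0`, `3 = Y1`), the polynomial `G` is
bigraded homogeneous of bidegree `(d1, d2)`. -/
def IsBihomogeneous (δ : ℕ) (d1 d2 : ℤ) (G : MvPolynomial (Fin 4) ℂ) : Prop :=
  ∀ m ∈ G.support, ((m 0 : ℤ) + (m 1 : ℤ) - (δ : ℤ) * (m 3 : ℤ) = d1) ∧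
    ((m 2 : ℤ) + (m 3 : ℤ) = d2)

theorem MvPolynomial.IsWeightedHomogeneous.exists_of_dvd {σ R : Type*} [CommRing R] [IsDomain R]
    {w : σ → ℕ} {n : ℕ} {d G : MvPolynomial σ R} (hG : IsWeightedHomogeneous w G n) (hG0 : G ≠ 0)
    (hd : d ∣ G) : ∃ k, IsWeightedHomogeneous w d k := by
  classical
  let ψ : MvPolynomial σ R →ₐ[R] Polynomial (MvPolynomial σ R) :=
    aeval fun i => Polynomial.C (X i) * Polynomial.X ^ w i
  have hmon (m : σ →₀ ℕ) (c : R) :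
      ψ (monomial m c) = Polynomial.monomial (Finsupp.weight w m) (monomial m c) := by
    have hX : (m.prod fun i k => (Polynomial.X ^ w i : Polynomial (MvPolynomial σ R)) ^ k) =
        Polynomial.X ^ Finsupp.weight w m := by
      rw [Finsupp.weight_apply, Finsupp.sum, ← Finset.prod_pow_eq_pow_sum]
      exact Finset.prod_congr rfl fun i _ => by simp only [← pow_mul, smul_eq_mul, mul_comm]
    simp only [ψ, aeval_monomial, mul_pow, Finsupp.prod_mul, hX]
    rw [MvPolynomial.monomial_eq, ← Polynomial.C_mul_X_pow_eq_monomial, map_mul, map_finsuppProd,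
      ← mul_assoc]
    simp [Polynomial.algebraMap_apply, MvPolynomial.algebraMap_eq]
  have hcoeff (p : MvPolynomial σ R) (k : ℕ) (m : σ →₀ ℕ) :
      coeff m ((ψ p).coeff k) = if Finsupp.weight w m = k then coeff m p else 0 := by
    induction p using MvPolynomial.induction_on' with
    | monomial u a =>
      rw [hmon, Polynomial.coeff_monomial]
      split_ifs <;> simp_all [MvPolynomial.coeff_monomial] <;> grind
    | add p q hp hq =>
      rw [map_add, Polynomial.coeff_add, coeff_add, hp, hq, coeff_add]
      split_ifs <;> simp
  have hψG : ψ G = Polynomial.monomial n G := by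
    ext k m
    rw [hcoeff, Polynomial.coeff_monomial]
    by_cases hm : coeff m G = 0
    · split_ifs <;> simp [hm]
    · rw [hG hm]
      split_ifs <;> simp
  obtain ⟨e, rfl⟩ := hd
  have hmul : ψ d * ψ e = Polynomial.monomial n (d * e) := by rw [← map_mul, hψG]
  have hne : ψ d * ψ e ≠ 0 := by simpa [hmul] using hG0
  have h1 := Polynomial.natDegree_mul (left_ne_zero_of_mul hne) (right_ne_zero_of_mul hne)
  have h2 := Polynomial.natTrailingDegree_mul (left_ne_zero_of_mul hne) (right_ne_zero_of_mul hne)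
  rw [hmul, Polynomial.natDegree_monomial_eq _ hG0] at h1
  rw [hmul, Polynomial.natTrailingDegree_monomial hG0] at h2
  have h3 := Polynomial.natTrailingDegree_le_natDegree (ψ d)
  have h4 := Polynomial.natTrailingDegree_le_natDegree (ψ e)
  refine ⟨(ψ d).natDegree, fun m hm => ?_⟩
  have h5 : (ψ d).coeff (Finsupp.weight w m) ≠ 0 := fun h => hm (by
    simpa [h] using (hcoeff d (Finsupp.weight w m) m).symm)
  have h6 := Polynomial.le_natDegree_of_ne_zero h5
  have h7 := Polynomial.natTrailingDegree_le_of_ne_zero h5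
  omega

namespace IsBihomogeneous

variable {δ : ℕ} {d1 d2 e1 e2 : ℤ} {F G : MvPolynomial (Fin 4) ℂ}

theorem add (hF : IsBihomogeneous δ d1 d2 F) (hG : IsBihomogeneous δ d1 d2 G) :
    IsBihomogeneous δ d1 d2 (F + G) := fun m hm => by
  classical
  rcases Finset.mem_union.1 (support_add hm) with h | h
  exacts [hF m h, hG m h]

theorem neg (hF : IsBihomogeneous δ d1 d2 F) : IsBihomogeneous δ d1 d2 (-F) := fun m hm =>
  hF m (by simpa using hm)

theorem C_mul (hF : IsBihomogeneous δ d1 d2 F) (c : ℂ) : IsBihomogeneous δ d1 d2 (C c * F) :=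
  fun m hm => hF m (by
    rw [mem_support_iff, coeff_C_mul] at hm
    exact mem_support_iff.2 (right_ne_zero_of_mul hm))

theorem mul (hF : IsBihomogeneous δ d1 d2 F) (hG : IsBihomogeneous δ e1 e2 G) :
    IsBihomogeneous δ (d1 + e1) (d2 + e2) (F * G) := fun m hm => by
  classical
  obtain ⟨a, ha, b, hb, rfl⟩ := Finset.mem_add.1 (support_mul F G hm)
  have h1 := hF a ha
  have h2 := hG b hb
  simp only [Finsupp.add_apply, Nat.cast_add]
  constructor <;> linarith

theorem of_X_mul (i : Fin 4) (h : IsBihomogeneous δ d1 d2 (X i * G))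
    (hi : IsBihomogeneous δ e1 e2 (X i)) : IsBihomogeneous δ (d1 - e1) (d2 - e2) G :=
  fun m hm => by
  have h1 := h (Finsupp.single i 1 + m) (by simpa [coeff_X_mul] using hm)
  have h2 := hi (Finsupp.single i 1) (by simp)
  simp only [Finsupp.add_apply, Nat.cast_add] at h1
  constructor <;> linarith

theorem X_zero : IsBihomogeneous δ 1 0 (X 0) := fun m hm => by
  obtain rfl := Finset.mem_singleton.1 (support_X (R := ℂ) ▸ hm)
  simp

theorem X_one : IsBihomogeneous δ 1 0 (X 1) := fun m hm => by
  obtain rfl := Finset.mem_singleton.1 (support_X (R := ℂ) ▸ hm)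
  simp

theorem X_two : IsBihomogeneous δ 0 1 (X 2) := fun m hm => by
  obtain rfl := Finset.mem_singleton.1 (support_X (R := ℂ) ▸ hm)
  simp

theorem X_three : IsBihomogeneous δ (-δ) 1 (X 3) := fun m hm => by
  obtain rfl := Finset.mem_singleton.1 (support_X (R := ℂ) ▸ hm)
  simp

/-- Bihomogeneity is homogeneity for the nonnegative weights `(1,1,δ,0)` and `(0,0,1,1)`. -/
theorem exists_of_dvd (hG : IsBihomogeneous δ d1 d2 G) (hG0 : G ≠ 0) (hd : F ∣ G) :
    ∃ e1 e2, IsBihomogeneous δ e1 e2 F := by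
  have hw (w : Fin 4 → ℕ) (m : Fin 4 →₀ ℕ) :
      Finsupp.weight w m = m 0 * w 0 + m 1 * w 1 + m 2 * w 2 + m 3 * w 3 := by
    simp [Finsupp.weight_apply, Finsupp.sum_fintype, Fin.sum_univ_four]
  have h1 : IsWeightedHomogeneous ![1, 1, δ, 0] G (d1 + δ * d2).toNat := fun m hm => by
    have hb := hG m (mem_support_iff.2 hm)
    have he : d1 + δ * d2 = ((m 0 + m 1 + m 2 * δ : ℕ) : ℤ) := by
      rw [← hb.1, ← hb.2]
      push_cast
      ring
    rw [hw, he, Int.toNat_natCast]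
    simp
  have h2 : IsWeightedHomogeneous ![0, 0, 1, 1] G d2.toNat := fun m hm => by
    have := hG m (mem_support_iff.2 hm)
    rw [hw, ← this.2]
    simp
    omega
  obtain ⟨k, hk⟩ := h1.exists_of_dvd hG0 hd
  obtain ⟨l, hl⟩ := h2.exists_of_dvd hG0 hd
  refine ⟨k - δ * l, l, fun m hm => ?_⟩
  have h3 := hk (mem_support_iff.1 hm)
  have h4 := hl (mem_support_iff.1 hm)
  rw [hw] at h3 h4
  rw [← h3, ← h4]
  simp
  ring

/-- Setting `X0 = Y0 = 1` does not merge monomials of the same bidegree. -/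
theorem coeff_aeval (hG : IsBihomogeneous δ d1 d2 G) {m : Fin 4 →₀ ℕ}
    (h1 : (m 0 : ℤ) + m 1 - δ * m 3 = d1) (h2 : (m 2 : ℤ) + m 3 = d2) :
    coeff (Finsupp.single 0 (m 1) + Finsupp.single 1 (m 3))
      (aeval ![1, X 0, 1, (X 1 : MvPolynomial (Fin 2) ℂ)] G) = coeff m G := by
  classical
  have hmon (s : Fin 4 →₀ ℕ) (c : ℂ) :
      aeval ![1, X 0, 1, (X 1 : MvPolynomial (Fin 2) ℂ)] (monomial s c) =
        monomial (Finsupp.single 0 (s 1) + Finsupp.single 1 (s 3)) c := by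
    rw [aeval_monomial, Finsupp.prod_fintype _ _ (by simp), Fin.prod_univ_four]
    simp [X_pow_eq_monomial, monomial_mul, algebraMap_eq, C_mul_monomial]
  conv_lhs => rw [G.as_sum]
  simp only [map_sum, hmon, coeff_sum, coeff_monomial]
  rw [Finset.sum_eq_single m]
  · simp
  · intro s hs hsm
    rw [if_neg]
    intro h
    have e0 : s 1 = m 1 := by simpa using DFunLike.congr_fun h 0
    have e1 : s 3 = m 3 := by simpa using DFunLike.congr_fun h 1
    obtain ⟨a, b⟩ := hG s hs
    rw [e0, e1] at a
    rw [e1] at b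
    apply hsm
    ext i
    fin_cases i <;> simp <;> omega
  · intro h
    simpa using h

theorem eq_zero_of_aeval (hG : IsBihomogeneous δ d1 d2 G)
    (h : aeval ![1, X 0, 1, (X 1 : MvPolynomial (Fin 2) ℂ)] G = 0) : G = 0 := by
  ext m
  by_contra hm
  have hb := hG m (mem_support_iff.2 hm)
  exact hm (by rw [← hG.coeff_aeval hb.1 hb.2, h, coeff_zero, coeff_zero])

/-- A polynomial that becomes a unit after setting `X0 = Y0 = 1` is a monomial in `X0, Y0`. -/
theorem isUnit_or_dvd (hG : IsBihomogeneous δ d1 d2 G)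
    (h : IsUnit (aeval ![1, X 0, 1, (X 1 : MvPolynomial (Fin 2) ℂ)] G)) :
    IsUnit G ∨ X 0 ∣ G ∨ X 2 ∣ G := by
  obtain ⟨c, hc, hcG⟩ := MvPolynomial.isUnit_iff_eq_C_of_isReduced.1 h
  have hz (m) (hm : m ∈ G.support) : m 1 = 0 ∧ m 3 = 0 := by
    have hb := hG m hm
    have h1 := hG.coeff_aeval hb.1 hb.2
    rw [hcG, coeff_C] at h1
    by_contra hcon
    rw [if_neg] at h1
    · exact mem_support_iff.1 hm h1.symm
    · intro h
      have e0 := DFunLike.congr_fun h 0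
      have e1 := DFunLike.congr_fun h 1
      simp at e0 e1
      omega
  have hG0 : G ≠ 0 := by
    rintro rfl
    simp at h
  obtain ⟨m, hm⟩ := support_nonempty.2 hG0
  have hGm : G = monomial m (coeff m G) := by
    apply eq_monomial_of_support_subset_singleton
    intro s hs
    have := hz m hm
    have := hz s hs
    have hb := hG m hm
    have hb' := hG s hs
    ext i
    fin_cases i <;> simp <;> grind
  rw [hGm, X_dvd_monomial, X_dvd_monomial]
  have := hz m hm
  by_cases h0 : m 0 = 0
  · by_cases h2 : m 2 = 0
    · left
      obtain rfl : m = 0 := by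
        ext i
        fin_cases i <;> simp <;> omega
      exact (isUnit_iff_ne_zero.2 (mem_support_iff.1 hm)).map C
    · exact .inr (.inr (.inr h2))
  · exact .inr (.inl (.inr h0))

end IsBihomogeneous

/-- Homogenization with respect to `X0` and `Y0`. -/
theorem exists_isBihomogeneous_aeval_eq (δ : ℕ) (d1 d2 : ℤ) (P : MvPolynomial (Fin 2) ℂ)
    (h1 : (P.totalDegree : ℤ) ≤ d1) (h2 : (P.totalDegree : ℤ) ≤ d2) :
    ∃ G, IsBihomogeneous δ d1 d2 G ∧
      aeval ![1, X 0, 1, (X 1 : MvPolynomial (Fin 2) ℂ)] G = P := by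
  classical
  let e (m : Fin 2 →₀ ℕ) : Fin 4 →₀ ℕ := Finsupp.equivFunOnFinite.symm
    ![(d1 + δ * m 1 - m 0).toNat, m 0, (d2 - m 1).toNat, m 1]
  refine ⟨∑ m ∈ P.support, monomial (e m) (coeff m P), fun s hs => ?_, ?_⟩
  · obtain ⟨m, hm, hs⟩ := Finset.mem_biUnion.1 (support_sum hs)
    obtain rfl := Finset.mem_singleton.1 (support_monomial_subset hs)
    have hle := le_totalDegree hm
    rw [Finsupp.sum_fintype _ _ (by simp), Fin.sum_univ_two] at hle
    have : 0 ≤ (δ : ℤ) * m 1 := by positivity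
    simp [e]
    omega
  · conv_rhs => rw [P.as_sum]
    rw [map_sum]
    refine Finset.sum_congr rfl fun m _ => ?_
    rw [aeval_monomial, Finsupp.prod_fintype _ _ (by simp), Fin.prod_univ_four, monomial_eq,
      Finsupp.prod_fintype _ _ (by simp), Fin.prod_univ_two]
    simp [e, algebraMap_eq]

/-- The requirements on an extension of `A dx + B dy`, apart from coprimality. -/
structure IsHirzebruchExtension (δ : ℕ) (A B : MvPolynomial (Fin 2) ℂ) (d1 d2 : ℤ)
    (A0 A1 B0 B1 : MvPolynomial (Fin 4) ℂ) : Prop where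
  bihomogeneous_A0 : IsBihomogeneous δ (d1 - δ + 1) (d2 + 2) A0
  bihomogeneous_A1 : IsBihomogeneous δ (d1 - δ + 1) (d2 + 2) A1
  bihomogeneous_B0 : IsBihomogeneous δ (d1 - δ + 2) (d2 + 1) B0
  bihomogeneous_B1 : IsBihomogeneous δ (d1 + 2) (d2 + 1) B1
  euler_X : X 0 * A0 + X 1 * A1 - (δ : MvPolynomial (Fin 4) ℂ) * (X 3 * B1) = 0
  euler_Y : X 2 * B0 + X 3 * B1 = 0
  aeval_A1 : aeval ![1, X 0, 1, X 1] A1 = A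
  aeval_B1 : aeval ![1, X 0, 1, X 1] B1 = B

theorem exists_isHirzebruchExtension (δ : ℕ) (A B : MvPolynomial (Fin 2) ℂ) :
    ∃ d1 d2 A0 A1 B0 B1, IsHirzebruchExtension δ A B d1 d2 A0 A1 B0 B1 := by
  let P := C (δ : ℂ) * (X 1 * B) - X 0 * A
  let N : ℤ := A.totalDegree + B.totalDegree + P.totalDegree + δ
  obtain ⟨A0, hA0, eA0⟩ := exists_isBihomogeneous_aeval_eq δ (N - δ + 1) (N + 2) P
    (by omega) (by omega)
  obtain ⟨A1, hA1, eA1⟩ := exists_isBihomogeneous_aeval_eq δ (N - δ + 1) (N + 2) A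
    (by omega) (by omega)
  obtain ⟨B1, hB1, eB1⟩ := exists_isBihomogeneous_aeval_eq δ (N + 2) N B (by omega) (by omega)
  have hYB : IsBihomogeneous δ (N + 2) (N + 1) (X 2 * B1) := by
    convert IsBihomogeneous.X_two.mul hB1 using 1 <;> ring
  refine ⟨N, N, A0, A1, -(X 3 * B1), X 2 * B1, hA0, hA1, ?_, hYB, ?_, by ring, eA1, by simp [eB1, -aeval_eq_bind₁]⟩
  · convert (IsBihomogeneous.X_three.mul hB1).neg using 1 <;> ring
  · have hh : IsBihomogeneous δ (N - δ + 2) (N + 2)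
        (X 0 * A0 + X 1 * A1 + C (-(δ : ℂ)) * (X 3 * (X 2 * B1))) := by
      refine .add (.add ?_ ?_) (.C_mul ?_ _)
      · convert IsBihomogeneous.X_zero.mul hA0 using 1 <;> ring
      · convert IsBihomogeneous.X_one.mul hA1 using 1 <;> ring
      · convert IsBihomogeneous.X_three.mul hYB using 1 <;> ring
    rw [← hh.eq_zero_of_aeval (by simp [eA0, eA1, eB1, P, -aeval_eq_bind₁])]
    simp
    ring

theorem MvPolynomial.totalDegree_le_totalDegree_X_mul {σ R : Type*} [CommRing R] [IsDomain R]
    (i : σ) (p : MvPolynomial σ R) : p.totalDegree ≤ (X i * p).totalDegree := by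
  by_cases hp : p = 0
  · simp [hp]
  · simp [totalDegree_mul_of_isDomain (X_ne_zero i) hp]

namespace IsHirzebruchExtension

variable {δ : ℕ} {A B : MvPolynomial (Fin 2) ℂ} {d1 d2 : ℤ}
  {A0 A1 B0 B1 : MvPolynomial (Fin 4) ℂ}

/-- A common factor `X0` or `Y0` can be cancelled. -/
theorem of_X_mul (i : Fin 4) {e1 e2 : ℤ} (hi : IsBihomogeneous δ e1 e2 (X i))
    (hi1 : aeval ![1, X 0, 1, (X 1 : MvPolynomial (Fin 2) ℂ)] (X i : MvPolynomial (Fin 4) ℂ) = 1)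
    (h : IsHirzebruchExtension δ A B d1 d2 (X i * A0) (X i * A1) (X i * B0) (X i * B1)) :
    IsHirzebruchExtension δ A B (d1 - e1) (d2 - e2) A0 A1 B0 B1 where
  bihomogeneous_A0 := by convert h.bihomogeneous_A0.of_X_mul i hi using 1 <;> ring
  bihomogeneous_A1 := by convert h.bihomogeneous_A1.of_X_mul i hi using 1 <;> ring
  bihomogeneous_B0 := by convert h.bihomogeneous_B0.of_X_mul i hi using 1 <;> ring
  bihomogeneous_B1 := by convert h.bihomogeneous_B1.of_X_mul i hi using 1 <;> ring
  euler_X := mul_left_cancel₀ (X_ne_zero i) (by linear_combination h.euler_X)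
  euler_Y := mul_left_cancel₀ (X_ne_zero i) (by linear_combination h.euler_Y)
  aeval_A1 := by simpa only [map_mul, hi1, one_mul] using h.aeval_A1
  aeval_B1 := by simpa only [map_mul, hi1, one_mul] using h.aeval_B1

/-- An extension of minimal degree has no common factor `X0` or `Y0`. -/
theorem exists_not_X_dvd (hne : ¬ (A = 0 ∧ B = 0))
    (h : IsHirzebruchExtension δ A B d1 d2 A0 A1 B0 B1) :
    ∃ d1 d2 A0 A1 B0 B1, IsHirzebruchExtension δ A B d1 d2 A0 A1 B0 B1 ∧
      ∀ i : Fin 4, i = 0 ∨ i = 2 → ¬ (X i ∣ A0 ∧ X i ∣ A1 ∧ X i ∣ B0 ∧ X i ∣ B1) := by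
  induction hn : A1.totalDegree + B1.totalDegree using Nat.strong_induction_on
    generalizing d1 d2 A0 A1 B0 B1 with
  | _ n ih =>
    by_cases hcon : ∀ i : Fin 4, i = 0 ∨ i = 2 →
        ¬ (X i ∣ A0 ∧ X i ∣ A1 ∧ X i ∣ B0 ∧ X i ∣ B1)
    · exact ⟨d1, d2, A0, A1, B0, B1, h, hcon⟩
    push Not at hcon
    obtain ⟨i, hi, ⟨A0, rfl⟩, ⟨A1, rfl⟩, ⟨B0, rfl⟩, ⟨B1, rfl⟩⟩ := hcon
    have hlt : A1.totalDegree + B1.totalDegree < n := by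
      have hA := totalDegree_le_totalDegree_X_mul i A1
      have hB := totalDegree_le_totalDegree_X_mul i B1
      by_cases hA1 : A1 = 0
      · have hB1 : B1 ≠ 0 := by
          rintro rfl
          exact hne ⟨by simpa [hA1] using h.aeval_A1.symm, by simpa using h.aeval_B1.symm⟩
        have := totalDegree_mul_of_isDomain (X_ne_zero (R := ℂ) i) hB1
        rw [totalDegree_X] at this
        omega
      · have := totalDegree_mul_of_isDomain (X_ne_zero (R := ℂ) i) hA1
        rw [totalDegree_X] at this
        omega
    rcases hi with rfl | rfl
    · exact ih _ hlt (h.of_X_mul 0 IsBihomogeneous.X_zero (by simp)) rfl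
    · exact ih _ hlt (h.of_X_mul 2 IsBihomogeneous.X_two (by simp)) rfl

theorem isUnit_of_dvd (h : IsHirzebruchExtension δ A B d1 d2 A0 A1 B0 B1)
    (hco : IsRelPrime A B) (hne : ¬ (A = 0 ∧ B = 0))
    (hX : ∀ i : Fin 4, i = 0 ∨ i = 2 → ¬ (X i ∣ A0 ∧ X i ∣ A1 ∧ X i ∣ B0 ∧ X i ∣ B1))
    {d : MvPolynomial (Fin 4) ℂ} (hA0 : d ∣ A0) (hA1 : d ∣ A1) (hB0 : d ∣ B0) (hB1 : d ∣ B1) :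
    IsUnit d := by
  have hu : IsUnit (aeval ![1, X 0, 1, (X 1 : MvPolynomial (Fin 2) ℂ)] d) := by
    apply hco
    · rw [← h.aeval_A1]
      exact map_dvd _ hA1
    · rw [← h.aeval_B1]
      exact map_dvd _ hB1
  have hd : ∃ e1 e2, IsBihomogeneous δ e1 e2 d := by
    by_cases hA : A1 = 0
    · refine h.bihomogeneous_B1.exists_of_dvd ?_ hB1
      rintro rfl
      exact hne ⟨by simpa [hA] using h.aeval_A1.symm, by simpa using h.aeval_B1.symm⟩
    · exact h.bihomogeneous_A1.exists_of_dvd hA hA1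
  obtain ⟨e1, e2, hd⟩ := hd
  rcases hd.isUnit_or_dvd hu with hd | hd | hd
  · exact hd
  · exact (hX 0 (.inl rfl)
      ⟨hd.trans hA0, hd.trans hA1, hd.trans hB0, hd.trans hB1⟩).elim
  · exact (hX 2 (.inr rfl)
      ⟨hd.trans hA0, hd.trans hA1, hd.trans hB0, hd.trans hB1⟩).elim

end IsHirzebruchExtension

/-- **Lemma 3.2.** For every `δ ∈ ℕ` and coprime `A, B ∈ ℂ[x,y]`, not both zero,
there are integers `d1, d2` and bigraded homogeneous polynomials
`A0, A1, B0, B1 ∈ ℂ[X0,X1,Y0,Y1]` of bidegrees `(d1−δ+1,d2+2)`, `(d1−δ+1,d2+2)`,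
`(d1−δ+2,d2+1)` and `(d1+2,d2+1)` satisfying the Euler-type conditions
`X0·A0 + X1·A1 − δ·Y1·B1 = 0` and `Y0·B0 + Y1·B1 = 0`, having no nonconstant
common factor, and with `A1(1,x,1,y) = A` and `B1(1,x,1,y) = B`. -/
theorem extension_to_Hirzebruch (δ : ℕ) (A B : MvPolynomial (Fin 2) ℂ)
    (hco : IsRelPrime A B) (hne : ¬ (A = 0 ∧ B = 0)) :
    ∃ (d1 d2 : ℤ) (A0 A1 B0 B1 : MvPolynomial (Fin 4) ℂ),
      IsBihomogeneous δ (d1 - δ + 1) (d2 + 2) A0 ∧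
      IsBihomogeneous δ (d1 - δ + 1) (d2 + 2) A1 ∧
      IsBihomogeneous δ (d1 - δ + 2) (d2 + 1) B0 ∧
      IsBihomogeneous δ (d1 + 2) (d2 + 1) B1 ∧
      X 0 * A0 + X 1 * A1 - (δ : MvPolynomial (Fin 4) ℂ) * (X 3 * B1) = 0 ∧
      X 2 * B0 + X 3 * B1 = 0 ∧
      (∀ d : MvPolynomial (Fin 4) ℂ, d ∣ A0 → d ∣ A1 → d ∣ B0 → d ∣ B1 → IsUnit d) ∧
      aeval ![1, X 0, 1, X 1] A1 = A ∧ aeval ![1, X 0, 1, X 1] B1 = B := by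
  obtain ⟨_, _, _, _, _, _, h⟩ := exists_isHirzebruchExtension δ A B
  obtain ⟨d1, d2, A0, A1, B0, B1, h, hX⟩ := h.exists_not_X_dvd hne
  exact ⟨d1, d2, A0, A1, B0, B1, h.bihomogeneous_A0, h.bihomogeneous_A1, h.bihomogeneous_B0,
    h.bihomogeneous_B1, h.euler_X, h.euler_Y, fun _ => h.isUnit_of_dvd hco hne hX, h.aeval_A1,
    h.aeval_B1⟩

end
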